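/- arXiv:2202.11600 — 2 statements merged into one kernel-verified Lean document; each statement's English description precedes it below -/
import Mathlib

section
/- (Flat-space case of the main theorem.) Let E be a finite-dimensional real inner product space, T > 0, m a natural number, and for each a ∈ {1,…,m} let X_a : E → E be a twice continuously differentiable vector field. Let c : ℝ → E be four times continuously differentiable on [0,T] with c'''' continuous, and let λ_a : ℝ → ℝ be twice continuously differentiable. Define the augmented functional J(c̃, λ̃) = ∫₀ᵀ ( ½‖c̃''(t)‖² + Σ_a λ̃_a(t) ⟪X_a(c̃(t)), c̃''(t)⟫ ) dt. Suppose (c, λ) is a normal extremal, i.e. for every smooth γ : ℝ → E with γ(0) = γ(T) = 0 and γ'(0) = γ'(T) = 0 and every smooth η_a : ℝ → ℝ, the derivative at s = 0 of s ↦ J(c + sγ, λ + sη) is zero. Then for every t ∈ [0,T]: (i) ⟪X_a(c(t)), c''(t)⟫ = 0 for every a (the acceleration constraints hold), and (ii) for every w ∈ E, ⟪c''''(t), w⟫ + Σ_a [ λ_a''(t) ⟪X_a(c(t)), w⟫ + 2λ_a'(t) ⟪(X_a∘c)'(t), w⟫ + λ_a(t) ⟪(X_a∘c)''(t), w⟫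 + λ_a(t) ⟪(fderiv X_a (c(t)))(w), c''(t)⟫ ] = 0. -/
open RealInnerProductSpace intervalIntegral

lemma aux_two {F : Type*} [NormedAddCommGroup F] [NormedSpace ℝ F] (f : ℝ → F)
    (hf : ContDiff ℝ 2 f) : (∀ t, HasDerivAt f (deriv f t) t) ∧
      (∀ t, HasDerivAt (deriv f) (iteratedDeriv 2 f t) t) ∧
      Continuous (iteratedDeriv 2 f) := by
  have hfd : ContDiff ℝ 1 (deriv f) := by
    have := hf.iterate_deriv' 1 1
    simpa using this
  refine ⟨fun t => (hf.differentiable (by norm_num) t).hasDerivAt, fun t => ?_,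
    hf.continuous_iteratedDeriv 2 le_rfl⟩
  rw [iteratedDeriv_succ, iteratedDeriv_one]
  exact (hfd.differentiable (by norm_num) t).hasDerivAt

lemma aux_param (T : ℝ) (hT : 0 < T) (F F' : ℝ → ℝ → ℝ)
    (hF : Continuous (Function.uncurry F)) (hF' : Continuous (Function.uncurry F'))
    (h : ∀ s t, HasDerivAt (fun s => F s t) (F' s t) s) :
    HasDerivAt (fun s => ∫ t in (0:ℝ)..T, F s t) (∫ t in (0:ℝ)..T, F' 0 t) 0 := by
  obtain ⟨C, hC⟩ := ((isCompact_Icc (a := (-1:ℝ)) (b := 1)).prod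
    (isCompact_Icc (a := (0:ℝ)) (b := T))).exists_bound_of_continuousOn hF'.continuousOn
  have hc : ∀ s, Continuous (F s) := fun s => hF.comp (by fun_prop : Continuous fun t => (s, t))
  have hc' : ∀ s, Continuous (F' s) := fun s => hF'.comp (by fun_prop : Continuous fun t => (s, t))
  refine (intervalIntegral.hasDerivAt_integral_of_dominated_loc_of_deriv_le (F := F) (F' := F')
    (s := Set.Icc (-1) 1) (bound := fun _ => C) (Icc_mem_nhds (by norm_num) (by norm_num)) ?_ ?_ ?_ ?_ ?_ ?_).2
  · exact Filter.Eventually.of_forall fun s => (hc s).aestronglyMeasurable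
  · exact (hc 0).intervalIntegrable _ _
  · exact (hc' 0).aestronglyMeasurable
  · refine Filter.Eventually.of_forall fun t ht s hs => ?_
    rw [Set.uIoc_of_le hT.le] at ht
    exact hC (s, t) ⟨hs, ht.1.le, ht.2⟩
  · exact intervalIntegrable_const
  · exact Filter.Eventually.of_forall fun t _ s _ => h s t

lemma aux_fund (T : ℝ) (hT : 0 < T) (f : ℝ → ℝ) (hf : Continuous f)
    (h : ∀ g : ℝ → ℝ, ContDiff ℝ (⊤ : ℕ∞) g → g 0 = 0 → g T = 0 → deriv g 0 = 0 → deriv g T = 0 →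
      ∫ t in (0:ℝ)..T, g t * f t = 0) : ∀ t ∈ Set.Icc 0 T, f t = 0 := by
  have hae := isOpen_Ioo (a := (0:ℝ)) (b := T) |>.ae_eq_zero_of_integral_contDiff_smul_eq_zero
    (μ := MeasureTheory.volume) (f := f) (hf.locallyIntegrable.locallyIntegrableOn _) ?_
  · have h2 : Set.EqOn f (fun _ => 0) (Set.Ioo 0 T) := by
      refine MeasureTheory.Measure.eqOn_open_of_ae_eq (μ := MeasureTheory.volume) ?_ isOpen_Ioo
        hf.continuousOn continuousOn_const
      exact (MeasureTheory.ae_restrict_iff' measurableSet_Ioo).2 hae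
    have h3 := h2.closure hf continuous_const
    rw [closure_Ioo hT.ne] at h3
    exact fun t ht => h3 ht
  · intro g hg hgc hgs
    have hz : ∀ x, x ∉ Set.Ioo 0 T → g x = 0 ∧ deriv g x = 0 := by
      intro x hx
      have hx' : x ∉ tsupport g := fun hh => hx (hgs hh)
      refine ⟨image_eq_zero_of_notMem_tsupport hx', ?_⟩
      have := (notMem_tsupport_iff_eventuallyEq.1 hx').deriv_eq
      rw [this]; simp
    have h0 := hz 0 (by simp)
    have h1 := hz T (by simp)
    rw [← h g hg h0.1 h1.1 h0.2 h1.2, intervalIntegral.integral_of_le hT.le]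
    refine (MeasureTheory.setIntegral_eq_integral_of_forall_compl_eq_zero ?_).symm
    intro x hx
    rw [(hz x fun hh => hx ⟨hh.1, hh.2.le⟩).1, zero_smul]

lemma aux_parts (T : ℝ) (v v1 v2 : ℝ → ℝ) (hv : ∀ t, HasDerivAt v (v1 t) t)
    (hv1 : ∀ t, HasDerivAt v1 (v2 t) t) (hv2 : Continuous v2)
    (g : ℝ → ℝ) (hg : ContDiff ℝ (⊤ : ℕ∞) g) (h0 : g 0 = 0) (h1 : g T = 0)
    (h0' : deriv g 0 = 0) (h1' : deriv g T = 0) :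
    ∫ t in (0:ℝ)..T, v t * iteratedDeriv 2 g t = ∫ t in (0:ℝ)..T, v2 t * g t := by
  have e : iteratedDeriv 2 g = deriv (deriv g) := by
    rw [iteratedDeriv_succ, iteratedDeriv_one]
  have hg2 : ContDiff ℝ 2 g := contDiff_infty.1 hg 2
  have hgd : ContDiff ℝ 1 (deriv g) := by
    have := hg2.iterate_deriv' 1 1
    simpa using this
  have hc1 : Continuous v1 := continuous_iff_continuousAt.2 fun t => (hv1 t).continuousAt
  have A := intervalIntegral.integral_mul_deriv_eq_deriv_mul (a := 0) (b := T)
    (u := v) (v := deriv g) (u' := v1) (v' := deriv (deriv g)) (fun t _ => hv t)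
    (fun t _ => (hgd.differentiable (by norm_num) t).hasDerivAt)
    (hc1.intervalIntegrable _ _) ((hgd.continuous_deriv (by norm_num)).intervalIntegrable _ _)
  have B := intervalIntegral.integral_mul_deriv_eq_deriv_mul (a := 0) (b := T)
    (u := v1) (v := g) (u' := v2) (v' := deriv g) (fun t _ => hv1 t)
    (fun t _ => (hg2.differentiable (by norm_num) t).hasDerivAt)
    (hv2.intervalIntegrable _ _) (hgd.continuous.intervalIntegrable _ _)
  rw [e, A, B, h0, h1, h0', h1']
  simp

/-- First variation. -/
lemma aux_var {E : Type*} [NormedAddCommGroup E] [InnerProductSpace ℝ E]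
    (T : ℝ) (hT : 0 < T) (m : ℕ) (X : Fin m → E → E) (hX : ∀ a, ContDiff ℝ 2 (X a))
    (c : ℝ → E) (hc : ContDiff ℝ 4 c)
    (lam : Fin m → ℝ → ℝ) (hlam : ∀ a, ContDiff ℝ 2 (lam a))
    (γ : ℝ → E) (η : Fin m → ℝ → ℝ)
    (hγ : ContDiff ℝ (⊤ : ℕ∞) γ) (hη : ∀ a, ContDiff ℝ (⊤ : ℕ∞) (η a)) :
    HasDerivAt (fun s : ℝ => ∫ t in (0:ℝ)..T,
        (1/2 : ℝ) * ‖iteratedDeriv 2 (fun u => c u + s • γ u) t‖ ^ 2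
          + ∑ a, (lam a t + s * η a t) *
              ⟪X a (c t + s • γ t), iteratedDeriv 2 (fun u => c u + s • γ u) t⟫)
      (∫ t in (0:ℝ)..T, (⟪iteratedDeriv 2 c t, iteratedDeriv 2 γ t⟫
        + ∑ a, (η a t * ⟪X a (c t), iteratedDeriv 2 c t⟫ +
          lam a t * (⟪X a (c t), iteratedDeriv 2 γ t⟫ +
            ⟪fderiv ℝ (X a) (c t) (γ t), iteratedDeriv 2 c t⟫)))) 0 := by
  have hγ2 : ContDiff ℝ 2 γ := contDiff_infty.1 hγ 2
  have hc2 : ContDiff ℝ 2 c := hc.of_le (by norm_num)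
  have e : ∀ s t : ℝ, iteratedDeriv 2 (fun u => c u + s • γ u) t
      = iteratedDeriv 2 c t + s • iteratedDeriv 2 γ t := by
    intro s t
    rw [iteratedDeriv_fun_add hc2.contDiffAt (hγ2.const_smul s).contDiffAt,
      iteratedDeriv_fun_const_smul_field]
  simp only [e]
  have hp : Continuous (iteratedDeriv 2 c) := hc2.continuous_iteratedDeriv 2 le_rfl
  have hq : Continuous (iteratedDeriv 2 γ) := hγ2.continuous_iteratedDeriv 2 le_rfl
  generalize iteratedDeriv 2 c = p at *
  generalize iteratedDeriv 2 γ = q at *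
  have k1 := hc.continuous
  have k2 := hγ.continuous
  have k3 := fun a => (hlam a).continuous
  have k4 := fun a => (hη a).continuous
  have k5 := fun a => (hX a).continuous
  have k6 := fun a => (hX a).continuous_fderiv (by norm_num)
  have key := aux_param T hT
    (fun s t => (1/2 : ℝ) * ‖p t + s • q t‖ ^ 2
          + ∑ a, (lam a t + s * η a t) * ⟪X a (c t + s • γ t), p t + s • q t⟫)
    (fun s t => ⟪p t + s • q t, q t⟫
        + ∑ a, (η a t * ⟪X a (c t + s • γ t), p t + s • q t⟫ +
          (lam a t + s * η a t) * (⟪X a (c t + s • γ t), q t⟫ +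
            ⟪fderiv ℝ (X a) (c t + s • γ t) (γ t), p t + s • q t⟫)))
    (by unfold Function.uncurry; fun_prop)
    (by unfold Function.uncurry; fun_prop) ?_
  · simpa using key
  · intro s t
    have d1 : HasDerivAt (fun s : ℝ => p t + s • q t) (q t) s := by
      simpa using ((hasDerivAt_id s).smul_const (q t)).const_add (p t)
    have d2 : HasDerivAt (fun s : ℝ => c t + s • γ t) (γ t) s := by
      simpa using ((hasDerivAt_id s).smul_const (γ t)).const_add (c t)
    have d3 := fun a => ((hX a).differentiable (by norm_num)
      (c t + s • γ t)).hasFDerivAt.comp_hasDerivAt s d2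
    have d4 : ∀ a, HasDerivAt (fun s : ℝ => lam a t + s * η a t) (η a t) s := fun a => by
      simpa using ((hasDerivAt_id s).mul_const (η a t)).const_add (lam a t)
    refine HasDerivAt.add ?_ (HasDerivAt.fun_sum fun a _ => ?_)
    · refine (d1.norm_sq.const_mul (1/2)).congr_deriv ?_
      ring
    · refine ((d4 a).mul ((d3 a).inner ℝ d1)).congr_deriv ?_
      rfl

/-- Flat-space case of the paper's Theorem 1: necessary conditions for normal
extremals of the minimal-acceleration problem subject to linear constraints on the
acceleration. If `(c, λ)` is a critical point of the augmented functional
`J(c̃, λ̃) = ∫₀ᵀ ½‖c̃''‖² + Σ_a λ̃_a ⟪X_a(c̃), c̃''⟫ dt` with respect to all smooth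
variations `γ` vanishing to first order at the endpoints and all smooth multiplier
variations `η`, then the constraints hold along `c` and the Euler–Lagrange-type
equation holds weakly against every `w ∈ E`. -/
theorem stmt_7 {E : Type*} [NormedAddCommGroup E] [InnerProductSpace ℝ E]
    [FiniteDimensional ℝ E]
    (T : ℝ) (hT : 0 < T) (m : ℕ) (X : Fin m → E → E) (hX : ∀ a, ContDiff ℝ 2 (X a))
    (c : ℝ → E) (hc : ContDiff ℝ 4 c) (hc4 : Continuous (iteratedDeriv 4 c))
    (lam : Fin m → ℝ → ℝ) (hlam : ∀ a, ContDiff ℝ 2 (lam a))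
    (hcrit : ∀ (γ : ℝ → E) (η : Fin m → ℝ → ℝ),
      ContDiff ℝ (⊤ : ℕ∞) γ → (∀ a, ContDiff ℝ (⊤ : ℕ∞) (η a)) →
      γ 0 = 0 → γ T = 0 → deriv γ 0 = 0 → deriv γ T = 0 →
      deriv (fun s : ℝ => ∫ t in (0:ℝ)..T,
        (1/2 : ℝ) * ‖iteratedDeriv 2 (fun u => c u + s • γ u) t‖ ^ 2
          + ∑ a, (lam a t + s * η a t) *
              ⟪X a (c t + s • γ t), iteratedDeriv 2 (fun u => c u + s • γ u) t⟫) 0 = 0) :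
    ∀ t ∈ Set.Icc (0:ℝ) T,
      (∀ a, ⟪X a (c t), iteratedDeriv 2 c t⟫ = 0) ∧
      (∀ w : E,
        ⟪iteratedDeriv 4 c t, w⟫
          + ∑ a, (iteratedDeriv 2 (lam a) t * ⟪X a (c t), w⟫
              + 2 * deriv (lam a) t * ⟪deriv (fun u => X a (c u)) t, w⟫
              + lam a t * ⟪iteratedDeriv 2 (fun u => X a (c u)) t, w⟫
              + lam a t * ⟪fderiv ℝ (X a) (c t) w, iteratedDeriv 2 c t⟫) = 0) := by
  have hc2 : ContDiff ℝ 2 c := hc.of_le (by norm_num)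
  have hp : Continuous (iteratedDeriv 2 c) := hc2.continuous_iteratedDeriv 2 le_rfl
  have k1 := hc.continuous
  have k3 := fun a => (hlam a).continuous
  have k5 := fun a => (hX a).continuous
  have k6 := fun a => (hX a).continuous_fderiv (by norm_num)
  have main := fun (γ : ℝ → E) (η : Fin m → ℝ → ℝ) h1 h2 h3 h4 h5 h6 =>
    (aux_var T hT m X hX c hc lam hlam γ η h1 h2).deriv.symm.trans (hcrit γ η h1 h2 h3 h4 h5 h6)
  intro t ht
  refine ⟨fun a => ?_, fun w => ?_⟩
  · refine aux_fund T hT (fun t => ⟪X a (c t), iteratedDeriv 2 c t⟫) (by fun_prop) ?_ t ht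
    intro g hg _ _ _ _
    have := main (fun _ => 0) (Pi.single a g) contDiff_const (fun b => by
      by_cases hb : b = a
      · subst hb; simpa using hg
      · simp only [Pi.single_eq_of_ne hb]; exact contDiff_const) rfl rfl (by simp) (by simp)
    refine Eq.trans ?_ this
    refine intervalIntegral.integral_congr fun t _ => ?_
    have e0 : iteratedDeriv 2 (fun _ : ℝ => (0:E)) t = 0 := by
      rw [iteratedDeriv_succ, iteratedDeriv_one]; simp
    simp only [e0, inner_zero_right, map_zero, inner_zero_left, add_zero, mul_zero, zero_add]
    rw [Finset.sum_eq_single a]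
    · simp
    · intro b _ hb; simp [Pi.single_eq_of_ne hb]
    · simp
  · have hXc : ∀ a, ContDiff ℝ 2 (fun u => X a (c u)) := fun a => (hX a).comp hc2
    have hl := fun a => aux_two (lam a) (hlam a)
    have hx := fun a => aux_two (fun u => X a (c u)) (hXc a)
    have hcc : ∀ t, HasDerivAt (iteratedDeriv 2 c) (iteratedDeriv 3 c t) t := fun t => by
      rw [iteratedDeriv_succ (n := 2)]
      exact (hc.differentiable_iteratedDeriv 2 (by norm_num) t).hasDerivAt
    have hcc' : ∀ t, HasDerivAt (iteratedDeriv 3 c) (iteratedDeriv 4 c t) t := fun t => by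
      rw [iteratedDeriv_succ (n := 3)]
      exact (hc.differentiable_iteratedDeriv 3 (by norm_num) t).hasDerivAt
    have m1 := fun a => (hl a).2.2
    have m2 := fun a => (hx a).2.2
    have m3 := fun a => (hlam a).continuous_deriv (by norm_num)
    have m4 := fun a => (hXc a).continuous_deriv (by norm_num)
    have hin : ∀ (f : ℝ → E) (f' : E) (t : ℝ), HasDerivAt f f' t →
        HasDerivAt (fun t => ⟪f t, w⟫) ⟪f', w⟫ t := fun f f' t h => by
      simpa using h.inner ℝ (hasDerivAt_const t w)
    refine aux_fund T hT (fun t => ⟪iteratedDeriv 4 c t, w⟫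
          + ∑ a, (iteratedDeriv 2 (lam a) t * ⟪X a (c t), w⟫
              + 2 * deriv (lam a) t * ⟪deriv (fun u => X a (c u)) t, w⟫
              + lam a t * ⟪iteratedDeriv 2 (fun u => X a (c u)) t, w⟫
              + lam a t * ⟪fderiv ℝ (X a) (c t) w, iteratedDeriv 2 c t⟫)) (by fun_prop) ?_ t ht
    intro g hg g0 gT g0' gT'
    have hg2 : ContDiff ℝ 2 g := contDiff_infty.1 hg 2
    have dg : ∀ t, deriv (fun t => g t • w) t = deriv g t • w := fun t =>
      ((hg2.differentiable (by norm_num) t).hasDerivAt.smul_const w).deriv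
    have ddg : ∀ t, iteratedDeriv 2 (fun t => g t • w) t = iteratedDeriv 2 g t • w := fun t => by
      rw [iteratedDeriv_succ, iteratedDeriv_one, funext dg]
      exact (((aux_two g hg2).2.1 t).smul_const w).deriv
    have M := main (fun t => g t • w) (fun _ _ => 0) (hg.smul contDiff_const)
      (fun _ => contDiff_const) (by simp [g0]) (by simp [gT]) (by simp [dg, g0'])
      (by simp [dg, gT'])
    simp only [ddg] at M
    have P := aux_parts T
      (fun t => ⟪iteratedDeriv 2 c t, w⟫ + ∑ a, lam a t * ⟪X a (c t), w⟫)
      (fun t => ⟪iteratedDeriv 3 c t, w⟫ + ∑ a, (deriv (lam a) t * ⟪X a (c t), w⟫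
        + lam a t * ⟪deriv (fun u => X a (c u)) t, w⟫))
      (fun t => ⟪iteratedDeriv 4 c t, w⟫ + ∑ a, ((iteratedDeriv 2 (lam a) t * ⟪X a (c t), w⟫
        + deriv (lam a) t * ⟪deriv (fun u => X a (c u)) t, w⟫)
        + (deriv (lam a) t * ⟪deriv (fun u => X a (c u)) t, w⟫
        + lam a t * ⟪iteratedDeriv 2 (fun u => X a (c u)) t, w⟫)))
      (fun t => (hin _ _ t (hcc t)).add (HasDerivAt.fun_sum fun a _ =>
        ((hl a).1 t).mul (hin _ _ t ((hx a).1 t))))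
      (fun t => (hin _ _ t (hcc' t)).add (HasDerivAt.fun_sum fun a _ =>
        (((hl a).2.1 t).mul (hin _ _ t ((hx a).1 t))).add
        (((hl a).1 t).mul (hin _ _ t ((hx a).2.1 t)))))
      (by fun_prop) g hg g0 gT g0' gT'
    have cg := hg.continuous
    have cg2 := (aux_two g hg2).2.2
    set R : ℝ → ℝ := fun t => ∑ a, lam a t * ⟪fderiv ℝ (X a) (c t) w, iteratedDeriv 2 c t⟫ with hR
    have cR : Continuous R := by rw [hR]; fun_prop
    have M' : ∫ t in (0:ℝ)..T, ((⟪iteratedDeriv 2 c t, w⟫ + ∑ a, lam a t * ⟪X a (c t), w⟫)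
        * iteratedDeriv 2 g t + g t * R t) = 0 := by
      refine Eq.trans ?_ M
      refine intervalIntegral.integral_congr fun t _ => ?_
      simp only [hR, inner_smul_right, map_smul, inner_smul_left, add_mul, Finset.sum_mul,
        Finset.mul_sum, zero_mul, zero_add, add_assoc, ← Finset.sum_add_distrib]
      congr 1
      · ring
      · refine Finset.sum_congr rfl fun a _ => ?_
        simp; ring
    rw [intervalIntegral.integral_add (Continuous.intervalIntegrable (by fun_prop) _ _)
      (Continuous.intervalIntegrable (by fun_prop) _ _), P,
      ← intervalIntegral.integral_add (Continuous.intervalIntegrable (by fun_prop) _ _)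
      (Continuous.intervalIntegrable (by fun_prop) _ _)] at M'
    refine Eq.trans ?_ M'
    refine intervalIntegral.integral_congr fun t _ => ?_
    simp only [hR, mul_add, add_mul, Finset.sum_mul,
        Finset.mul_sum, add_assoc, ← Finset.sum_add_distrib]
    congr 1
    · ring
    · refine Finset.sum_congr rfl fun a _ => ?_
      ring
end

section
/- (Planar rigid body with obstacle avoidance.) Let m > 0, J > 0, T > 0, σ ≥ 0, τ > 0, r > 0. Let x, y, θ : ℝ → ℝ be four times continuously differentiable on [0,T] with x(t)² + y(t)² > r² for all t ∈ [0,T], and let λ : ℝ → ℝ be twice continuously differentiable. Define the augmented action A(x̃, ỹ, θ̃, λ̃) = ∫₀ᵀ [ ½( m x̃''² + m ỹ''² + J θ̃''² ) + ½ σ ( m x̃'² + m ỹ'² + J θ̃'² ) + ½ τ / (x̃² + ỹ² − r²) + λ̃ ( sin θ̃ · x̃'' − cos θ̃ · ỹ'' ) ] dt. Suppose that for all smooth γ₁, γ₂, γ₃ : ℝ → ℝ vanishing together with their first derivatives at t = 0 and t = T, and all smooth η : ℝ → ℝ, the derivative at s = 0 of s ↦ A(x + sγ₁, y + sγ₂,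 θ + sγ₃, λ + sη) is zero. Then for all t ∈ [0,T]: sin θ · x'' − cos θ · y'' = 0, and x'''' − σ x'' + (λ''/m) sin θ + 2(λ'/m) θ' cos θ + (λ/m)(θ'' cos θ − (θ')² sin θ) − τ x / ( m (x² + y² − r²)² ) = 0, y'''' − σ y'' − (λ''/m) cos θ + 2(λ'/m) θ' sin θ + (λ/m)(θ'' sin θ + (θ')² cos θ) − τ y / ( m (x² + y² − r²)² ) = 0, θ'''' − σ θ'' + (λ/J)(cos θ · x'' + sin θ · y'') = 0. -/
open intervalIntegral

lemma aux_hd {n : ℕ} {f : ℝ → ℝ} (hf : ContDiff ℝ n f) (k : ℕ) (hk : k < n) (t : ℝ) :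
    HasDerivAt (iteratedDeriv k f) (iteratedDeriv (k+1) f t) t := by
  rw [iteratedDeriv_succ]
  exact ((hf.differentiable_iteratedDeriv k (by exact_mod_cast hk)) t).hasDerivAt

lemma aux_diff {T : ℝ} (hT : 0 < T) (F F' : ℝ → ℝ → ℝ) (V : Set ℝ) (hV : IsOpen V)
    (h0 : (0:ℝ) ∈ V)
    (hF : ContinuousOn (fun p : ℝ × ℝ => F p.1 p.2) (V ×ˢ Set.Icc 0 T))
    (hF' : ContinuousOn (fun p : ℝ × ℝ => F' p.1 p.2) (V ×ˢ Set.Icc 0 T))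
    (hd : ∀ s ∈ V, ∀ t ∈ Set.Icc (0:ℝ) T, HasDerivAt (fun s => F s t) (F' s t) s) :
    HasDerivAt (fun s => ∫ t in (0:ℝ)..T, F s t) (∫ t in (0:ℝ)..T, F' 0 t) 0 := by
  obtain ⟨ε, hε, hεV⟩ := Metric.nhds_basis_closedBall.mem_iff.1 (hV.mem_nhds h0)
  have hsl : ∀ s ∈ V, ContinuousOn (F s) (Set.Icc 0 T) := fun s hs =>
    hF.comp (f := fun t => (s, t)) (by fun_prop) (fun t ht => ⟨hs, ht⟩)
  have hsl' : ∀ s ∈ V, ContinuousOn (F' s) (Set.Icc 0 T) := fun s hs =>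
    hF'.comp (f := fun t => (s, t)) (by fun_prop) (fun t ht => ⟨hs, ht⟩)
  have hsub : Set.uIoc 0 T ⊆ Set.Icc 0 T := by
    rw [Set.uIoc_of_le hT.le]; exact Set.Ioc_subset_Icc_self
  obtain ⟨C, hC⟩ := ((isCompact_closedBall (0:ℝ) ε).prod
    (isCompact_Icc (a := (0:ℝ)) (b := T))).exists_bound_of_continuousOn
    (hF'.mono (Set.prod_mono hεV subset_rfl))
  refine (intervalIntegral.hasDerivAt_integral_of_dominated_loc_of_deriv_le
    (bound := fun _ => C) (Metric.closedBall_mem_nhds (0:ℝ) hε) ?_ ?_ ?_ ?_ ?_ ?_).2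
  · filter_upwards [hV.mem_nhds h0] with s hs
    exact ((hsl s hs).mono hsub).aestronglyMeasurable measurableSet_uIoc
  · exact (hsl 0 h0).intervalIntegrable_of_Icc hT.le
  · exact ((hsl' 0 h0).mono hsub).aestronglyMeasurable measurableSet_uIoc
  · exact Filter.Eventually.of_forall fun t ht s hs => hC (s, t) ⟨hs, hsub ht⟩
  · exact intervalIntegrable_const
  · exact Filter.Eventually.of_forall fun t ht s hs => hd s (hεV hs) t (hsub ht)

lemma aux_EL {T : ℝ} (hT : 0 < T) (P P1 P2 Q Q1 R : ℝ → ℝ)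
    (hP : ∀ t, HasDerivAt P (P1 t) t) (hP1 : ∀ t, HasDerivAt P1 (P2 t) t)
    (hP2 : Continuous P2) (hQ : ∀ t, HasDerivAt Q (Q1 t) t) (hQ1 : Continuous Q1)
    (hR : ContinuousOn R (Set.Icc 0 T))
    (h : ∀ γ : ℝ → ℝ, ContDiff ℝ (⊤ : ℕ∞) γ → γ 0 = 0 → γ T = 0 → deriv γ 0 = 0 →
      deriv γ T = 0 →
      ∫ t in (0:ℝ)..T, (P t * iteratedDeriv 2 γ t + Q t * deriv γ t + R t * γ t) = 0) :
    ∀ t ∈ Set.Icc (0:ℝ) T, P2 t - Q1 t + R t = 0 := by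
  have cP : Continuous P := continuous_iff_continuousAt.2 fun t => (hP t).continuousAt
  have cP1 : Continuous P1 := continuous_iff_continuousAt.2 fun t => (hP1 t).continuousAt
  have cQ : Continuous Q := continuous_iff_continuousAt.2 fun t => (hQ t).continuousAt
  have cf : ContinuousOn (fun t => P2 t - Q1 t + R t) (Set.Icc 0 T) := by fun_prop
  have key : ∀ᵐ t, t ∈ Set.Ioo 0 T → P2 t - Q1 t + R t = 0 := by
    apply isOpen_Ioo.ae_eq_zero_of_integral_contDiff_smul_eq_zero
    · exact (cf.mono Set.Ioo_subset_Icc_self).locallyIntegrableOn measurableSet_Ioo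
    intro g hg hgc hgs
    have d1 : ∀ t, HasDerivAt g (deriv g t) t := fun t =>
      ((hg.differentiable (by simp)) t).hasDerivAt
    have hg1 : ContDiff ℝ (⊤ : ℕ∞) (deriv g) := by
      exact (contDiff_infty_iff_deriv.1 hg).2
    have d2 : ∀ t, HasDerivAt (deriv g) (iteratedDeriv 2 g t) t := fun t => by
      rw [iteratedDeriv_succ, iteratedDeriv_one]
      exact ((hg1.differentiable (by simp)) t).hasDerivAt
    have c2 : Continuous (iteratedDeriv 2 g) := (contDiff_infty.1 hg 2).continuous_iteratedDeriv 2 le_rfl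
    have z : ∀ t, t ∉ Set.Ioo 0 T → g t = 0 := fun t ht =>
      image_eq_zero_of_notMem_tsupport fun h => ht (hgs h)
    have z1 : ∀ t, t ∉ Set.Ioo 0 T → deriv g t = 0 := fun t ht =>
      image_eq_zero_of_notMem_tsupport fun h => ht (hgs (tsupport_deriv_subset h))
    have n0 : (0:ℝ) ∉ Set.Ioo 0 T := by simp
    have nT : T ∉ Set.Ioo 0 T := by simp
    have H := h g hg (z _ n0) (z _ nT) (z1 _ n0) (z1 _ nT)
    have cg := hg.continuous
    have cg1 := hg1.continuous
    have I1 := intervalIntegral.integral_mul_deriv_eq_deriv_mul (a := 0) (b := T)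
      (fun t _ => hP t) (fun t _ => d2 t) (cP1.intervalIntegrable _ _) (c2.intervalIntegrable _ _)
    have I2 := intervalIntegral.integral_mul_deriv_eq_deriv_mul (a := 0) (b := T)
      (fun t _ => hP1 t) (fun t _ => d1 t) (hP2.intervalIntegrable _ _) (cg1.intervalIntegrable _ _)
    have I3 := intervalIntegral.integral_mul_deriv_eq_deriv_mul (a := 0) (b := T)
      (fun t _ => hQ t) (fun t _ => d1 t) (hQ1.intervalIntegrable _ _) (cg1.intervalIntegrable _ _)
    rw [z1 _ n0, z1 _ nT] at I1
    rw [z _ n0, z _ nT] at I2 I3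
    have iR : IntervalIntegrable (fun t => R t * g t) MeasureTheory.volume 0 T :=
      ContinuousOn.intervalIntegrable_of_Icc hT.le (by fun_prop)
    have e1 : IntervalIntegrable (fun t => P t * iteratedDeriv 2 g t) MeasureTheory.volume 0 T :=
      (cP.mul c2).intervalIntegrable _ _
    have e2 : IntervalIntegrable (fun t => Q t * deriv g t) MeasureTheory.volume 0 T :=
      (cQ.mul cg1).intervalIntegrable _ _
    have e3 : IntervalIntegrable (fun t => P2 t * g t) MeasureTheory.volume 0 T :=
      (hP2.mul cg).intervalIntegrable _ _
    have e4 : IntervalIntegrable (fun t => Q1 t * g t) MeasureTheory.volume 0 T :=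
      (hQ1.mul cg).intervalIntegrable _ _
    rw [intervalIntegral.integral_add (e1.add e2) iR, intervalIntegral.integral_add e1 e2] at H
    have K : ∫ t in (0:ℝ)..T, (P2 t * g t - Q1 t * g t + R t * g t) = 0 := by
      rw [intervalIntegral.integral_add (e3.sub e4) iR, intervalIntegral.integral_sub e3 e4]
      linarith
    rw [← K, intervalIntegral.integral_of_le hT.le, MeasureTheory.integral_Ioc_eq_integral_Ioo,
      ← MeasureTheory.setIntegral_eq_integral_of_forall_compl_eq_zero (s := Set.Ioo 0 T)]
    · congr 1; ext t; simp only [smul_eq_mul]; ring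
    · intro t ht; simp [z t ht]
  have := MeasureTheory.Measure.eqOn_Icc_of_ae_eq (μ := MeasureTheory.volume) hT.ne
    (f := fun t => P2 t - Q1 t + R t) (g := fun _ => 0) ?_ cf continuousOn_const
  · exact this
  · rw [Filter.EventuallyEq, ← MeasureTheory.restrict_Ioo_eq_restrict_Icc,
      MeasureTheory.ae_restrict_iff' measurableSet_Ioo]
    exact key

lemma aux_fv (m J T σ τ r : ℝ) (hT : 0 < T)
    (x x1 x2 y y1 y2 θ θ1 θ2 lam a a1 a2 b b1 b2 c c1 c2 η : ℝ → ℝ)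
    (hx : Continuous x) (hx1 : Continuous x1) (hx2 : Continuous x2)
    (hy : Continuous y) (hy1 : Continuous y1) (hy2 : Continuous y2)
    (hθ : Continuous θ) (hθ1 : Continuous θ1) (hθ2 : Continuous θ2) (hlam : Continuous lam)
    (ha : Continuous a) (ha1 : Continuous a1) (ha2 : Continuous a2)
    (hb : Continuous b) (hb1 : Continuous b1) (hb2 : Continuous b2)
    (hc : Continuous c) (hc1 : Continuous c1) (hc2 : Continuous c2) (hη : Continuous η)
    (hobs : ∀ t ∈ Set.Icc (0:ℝ) T, (x t) ^ 2 + (y t) ^ 2 > r ^ 2) :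
    HasDerivAt (fun s : ℝ => ∫ t in (0:ℝ)..T,
        ((1/2 : ℝ) * (m * (x2 t + s * a2 t) ^ 2 + m * (y2 t + s * b2 t) ^ 2
            + J * (θ2 t + s * c2 t) ^ 2)
          + (1/2 : ℝ) * σ * (m * (x1 t + s * a1 t) ^ 2 + m * (y1 t + s * b1 t) ^ 2
            + J * (θ1 t + s * c1 t) ^ 2)
          + (1/2 : ℝ) * τ / ((x t + s * a t) ^ 2 + (y t + s * b t) ^ 2 - r ^ 2)
          + (lam t + s * η t) *
              (Real.sin (θ t + s * c t) * (x2 t + s * a2 t)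
                - Real.cos (θ t + s * c t) * (y2 t + s * b2 t))))
      (∫ t in (0:ℝ)..T, (m * x2 t * a2 t + m * y2 t * b2 t + J * θ2 t * c2 t
          + σ * (m * x1 t * a1 t + m * y1 t * b1 t + J * θ1 t * c1 t)
          - τ * (x t * a t + y t * b t) / (x t ^ 2 + y t ^ 2 - r ^ 2) ^ 2
          + η t * (Real.sin (θ t) * x2 t - Real.cos (θ t) * y2 t)
          + lam t * (Real.cos (θ t) * c t * x2 t + Real.sin (θ t) * a2 t
              + Real.sin (θ t) * c t * y2 t - Real.cos (θ t) * b2 t))) 0 := by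
  have hcD : Continuous fun p : ℝ × ℝ =>
      (x p.2 + p.1 * a p.2) ^ 2 + (y p.2 + p.1 * b p.2) ^ 2 - r ^ 2 := by fun_prop
  obtain ⟨V, W, hV, hW, h0V, hW', hVW⟩ := generalized_tube_lemma (isCompact_singleton (x := (0:ℝ)))
    (isCompact_Icc (a := (0:ℝ)) (b := T)) (isOpen_lt continuous_const hcD : IsOpen
      {p : ℝ × ℝ | 0 < (x p.2 + p.1 * a p.2) ^ 2 + (y p.2 + p.1 * b p.2) ^ 2 - r ^ 2}) (by
      rintro ⟨s, t⟩ ⟨hs, ht⟩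
      have := hobs t ht
      simp only [Set.mem_singleton_iff] at hs
      subst hs
      simp only [Set.mem_ofPred_eq, zero_mul, add_zero]
      linarith)
  have hD : ∀ s ∈ V, ∀ t ∈ Set.Icc (0:ℝ) T,
      (x t + s * a t) ^ 2 + (y t + s * b t) ^ 2 - r ^ 2 ≠ 0 := fun s hs t ht =>
    (show 0 < (x t + s * a t) ^ 2 + (y t + s * b t) ^ 2 - r ^ 2 from
      @hVW (s, t) ⟨hs, hW' ht⟩).ne'
  have main := aux_diff hT (fun s t => (1/2 : ℝ) * (m * (x2 t + s * a2 t) ^ 2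
            + m * (y2 t + s * b2 t) ^ 2 + J * (θ2 t + s * c2 t) ^ 2)
          + (1/2 : ℝ) * σ * (m * (x1 t + s * a1 t) ^ 2 + m * (y1 t + s * b1 t) ^ 2
            + J * (θ1 t + s * c1 t) ^ 2)
          + (1/2 : ℝ) * τ / ((x t + s * a t) ^ 2 + (y t + s * b t) ^ 2 - r ^ 2)
          + (lam t + s * η t) *
              (Real.sin (θ t + s * c t) * (x2 t + s * a2 t)
                - Real.cos (θ t + s * c t) * (y2 t + s * b2 t)))
      (fun s t => m * (x2 t + s * a2 t) * a2 t + m * (y2 t + s * b2 t) * b2 t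
          + J * (θ2 t + s * c2 t) * c2 t
          + σ * (m * (x1 t + s * a1 t) * a1 t + m * (y1 t + s * b1 t) * b1 t
          + J * (θ1 t + s * c1 t) * c1 t)
          - τ * ((x t + s * a t) * a t + (y t + s * b t) * b t) /
            ((x t + s * a t) ^ 2 + (y t + s * b t) ^ 2 - r ^ 2) ^ 2
          + η t * (Real.sin (θ t + s * c t) * (x2 t + s * a2 t)
            - Real.cos (θ t + s * c t) * (y2 t + s * b2 t))
          + (lam t + s * η t) * (Real.cos (θ t + s * c t) * c t * (x2 t + s * a2 t)
              + Real.sin (θ t + s * c t) * a2 t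
              + Real.sin (θ t + s * c t) * c t * (y2 t + s * b2 t)
              - Real.cos (θ t + s * c t) * b2 t)) V hV (h0V rfl) ?_ ?_ ?_
  · simpa only [zero_mul, add_zero] using main
  · have hq : ContinuousOn (fun p : ℝ × ℝ => (1/2 : ℝ) * τ /
        ((x p.2 + p.1 * a p.2) ^ 2 + (y p.2 + p.1 * b p.2) ^ 2 - r ^ 2)) (V ×ˢ Set.Icc 0 T) :=
      continuousOn_const.div hcD.continuousOn fun p hp => hD p.1 hp.1 p.2 hp.2
    refine (ContinuousOn.add (Continuous.continuousOn ?_) hq).add (Continuous.continuousOn ?_) <;>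
      fun_prop
  · have hq : ContinuousOn (fun p : ℝ × ℝ =>
        τ * ((x p.2 + p.1 * a p.2) * a p.2 + (y p.2 + p.1 * b p.2) * b p.2) /
        ((x p.2 + p.1 * a p.2) ^ 2 + (y p.2 + p.1 * b p.2) ^ 2 - r ^ 2) ^ 2)
        (V ×ˢ Set.Icc 0 T) :=
      ContinuousOn.div (by fun_prop) (hcD.pow 2).continuousOn
        fun p hp => pow_ne_zero 2 (hD p.1 hp.1 p.2 hp.2)
    refine ((ContinuousOn.sub (Continuous.continuousOn ?_) hq).add
      (Continuous.continuousOn ?_)).add (Continuous.continuousOn ?_) <;> fun_prop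
  · intro s hs t ht
    have hne := hD s hs t ht
    have l : ∀ u v : ℝ, HasDerivAt (fun s : ℝ => u + s * v) v s := fun u v => by
      simpa using ((hasDerivAt_id s).mul_const v).const_add u
    have q : ∀ u v : ℝ, HasDerivAt (fun s : ℝ => (u + s * v) ^ 2) (2 * (u + s * v) * v) s :=
      fun u v => ((l u v).fun_pow 2).congr_deriv (by norm_num)
    have h1 := ((((q (x2 t) (a2 t)).const_mul m).add ((q (y2 t) (b2 t)).const_mul m)).add
      ((q (θ2 t) (c2 t)).const_mul J)).const_mul (1/2 : ℝ)
    have h2 := ((((q (x1 t) (a1 t)).const_mul m).add ((q (y1 t) (b1 t)).const_mul m)).add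
      ((q (θ1 t) (c1 t)).const_mul J)).const_mul (1/2 * σ : ℝ)
    have h3 := (hasDerivAt_const s (1/2 * τ : ℝ)).div
      (((q (x t) (a t)).add (q (y t) (b t))).sub_const (r ^ 2)) hne
    have h4 := (l (lam t) (η t)).mul (((l (θ t) (c t)).sin.mul (l (x2 t) (a2 t))).sub
      ((l (θ t) (c t)).cos.mul (l (y2 t) (b2 t))))
    refine (((h1.add h2).add h3).add h4).congr_deriv ?_
    simp only [Pi.add_apply, Pi.sub_apply, Pi.mul_apply]
    field_simp
    ring

/-- The paper's planar rigid body example of Theorem 2 (obstacle avoidance):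
necessary conditions for normal extremals of the augmented action
`A = ∫₀ᵀ ½(m ẍ² + m ÿ² + J θ̈²) + ½σ(m ẋ² + m ẏ² + J θ̇²) + ½τ/(x² + y² − r²)
      + λ (sin θ · ẍ − cos θ · ÿ) dt`. -/
theorem stmt_10 (m J T σ τ r : ℝ) (hm : 0 < m) (hJ : 0 < J) (hT : 0 < T)
    (hσ : 0 ≤ σ) (hτ : 0 < τ) (hr : 0 < r)
    (x y θ : ℝ → ℝ) (lam : ℝ → ℝ)
    (hx : ContDiff ℝ 4 x) (hy : ContDiff ℝ 4 y) (hθ : ContDiff ℝ 4 θ)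
    (hobs : ∀ t ∈ Set.Icc (0:ℝ) T, (x t) ^ 2 + (y t) ^ 2 > r ^ 2)
    (hlam : ContDiff ℝ 2 lam)
    (hcrit : ∀ γ₁ γ₂ γ₃ η : ℝ → ℝ,
      ContDiff ℝ (⊤ : ℕ∞) γ₁ → ContDiff ℝ (⊤ : ℕ∞) γ₂ → ContDiff ℝ (⊤ : ℕ∞) γ₃ → ContDiff ℝ (⊤ : ℕ∞) η →
      γ₁ 0 = 0 → γ₁ T = 0 → deriv γ₁ 0 = 0 → deriv γ₁ T = 0 →
      γ₂ 0 = 0 → γ₂ T = 0 → deriv γ₂ 0 = 0 → deriv γ₂ T = 0 →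
      γ₃ 0 = 0 → γ₃ T = 0 → deriv γ₃ 0 = 0 → deriv γ₃ T = 0 →
      deriv (fun s : ℝ => ∫ t in (0:ℝ)..T,
        (1/2 : ℝ) * (m * (iteratedDeriv 2 (fun u => x u + s * γ₁ u) t) ^ 2
            + m * (iteratedDeriv 2 (fun u => y u + s * γ₂ u) t) ^ 2
            + J * (iteratedDeriv 2 (fun u => θ u + s * γ₃ u) t) ^ 2)
          + (1/2 : ℝ) * σ * (m * (deriv (fun u => x u + s * γ₁ u) t) ^ 2
            + m * (deriv (fun u => y u + s * γ₂ u) t) ^ 2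
            + J * (deriv (fun u => θ u + s * γ₃ u) t) ^ 2)
          + (1/2 : ℝ) * τ / ((x t + s * γ₁ t) ^ 2 + (y t + s * γ₂ t) ^ 2 - r ^ 2)
          + (lam t + s * η t) *
              (Real.sin (θ t + s * γ₃ t) * iteratedDeriv 2 (fun u => x u + s * γ₁ u) t
                - Real.cos (θ t + s * γ₃ t) * iteratedDeriv 2 (fun u => y u + s * γ₂ u) t)) 0
        = 0) :
    ∀ t ∈ Set.Icc (0:ℝ) T,
      Real.sin (θ t) * iteratedDeriv 2 x t - Real.cos (θ t) * iteratedDeriv 2 y t = 0 ∧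
      iteratedDeriv 4 x t - σ * iteratedDeriv 2 x t
          + (iteratedDeriv 2 lam t / m) * Real.sin (θ t)
          + 2 * (deriv lam t / m) * deriv θ t * Real.cos (θ t)
          + (lam t / m) * (iteratedDeriv 2 θ t * Real.cos (θ t)
              - (deriv θ t) ^ 2 * Real.sin (θ t))
          - τ * x t / (m * ((x t) ^ 2 + (y t) ^ 2 - r ^ 2) ^ 2) = 0 ∧
      iteratedDeriv 4 y t - σ * iteratedDeriv 2 y t
          - (iteratedDeriv 2 lam t / m) * Real.cos (θ t)
          + 2 * (deriv lam t / m) * deriv θ t * Real.sin (θ t)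
          + (lam t / m) * (iteratedDeriv 2 θ t * Real.sin (θ t)
              + (deriv θ t) ^ 2 * Real.cos (θ t))
          - τ * y t / (m * ((x t) ^ 2 + (y t) ^ 2 - r ^ 2) ^ 2) = 0 ∧
      iteratedDeriv 4 θ t - σ * iteratedDeriv 2 θ t
          + (lam t / J) * (Real.cos (θ t) * iteratedDeriv 2 x t
              + Real.sin (θ t) * iteratedDeriv 2 y t) = 0 := by
  have hxd := fun k hk => aux_hd (n := 4) hx k hk
  have hyd := fun k hk => aux_hd (n := 4) hy k hk
  have hθd := fun k hk => aux_hd (n := 4) hθ k hk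
  have hld := fun k hk => aux_hd (n := 2) hlam k hk
  have hxc : ∀ k : ℕ, k ≤ 4 → Continuous (iteratedDeriv k x) := fun k hk =>
    hx.continuous_iteratedDeriv k (by exact_mod_cast hk)
  have hyc : ∀ k : ℕ, k ≤ 4 → Continuous (iteratedDeriv k y) := fun k hk =>
    hy.continuous_iteratedDeriv k (by exact_mod_cast hk)
  have hθc : ∀ k : ℕ, k ≤ 4 → Continuous (iteratedDeriv k θ) := fun k hk =>
    hθ.continuous_iteratedDeriv k (by exact_mod_cast hk)
  have hlc : ∀ k : ℕ, k ≤ 2 → Continuous (iteratedDeriv k lam) := fun k hk =>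
    hlam.continuous_iteratedDeriv k (by exact_mod_cast hk)
  have D1 : ∀ (f g : ℝ → ℝ), ContDiff ℝ 4 f → ContDiff ℝ (⊤ : ℕ∞) g → ∀ s t : ℝ,
      deriv (fun u => f u + s * g u) t = deriv f t + s * deriv g t := by
    intro f g hf hg s t
    have h1 := ((hf.differentiable (by simp)) t).hasDerivAt
    have h2 := ((hg.differentiable (by simp)) t).hasDerivAt
    exact (h1.add (h2.const_mul s)).deriv
  have D2 : ∀ (f g : ℝ → ℝ), ContDiff ℝ 4 f → ContDiff ℝ (⊤ : ℕ∞) g → ∀ s t : ℝ,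
      iteratedDeriv 2 (fun u => f u + s * g u) t
        = iteratedDeriv 2 f t + s * iteratedDeriv 2 g t := by
    intro f g hf hg s t
    have e : deriv (fun u => f u + s * g u) = fun t => deriv f t + s * deriv g t :=
      funext (D1 f g hf hg s)
    have h1 := aux_hd (n := 4) hf 1 (by norm_num) t
    have h2 := aux_hd (n := 4) (contDiff_infty.1 hg 4) 1 (by norm_num) t
    rw [iteratedDeriv_succ, iteratedDeriv_one, e]
    rw [iteratedDeriv_one] at h1 h2
    exact (h1.add (h2.const_mul s)).deriv
  have fv : ∀ γ₁ γ₂ γ₃ η : ℝ → ℝ,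
      ContDiff ℝ (⊤ : ℕ∞) γ₁ → ContDiff ℝ (⊤ : ℕ∞) γ₂ → ContDiff ℝ (⊤ : ℕ∞) γ₃ →
      ContDiff ℝ (⊤ : ℕ∞) η →
      γ₁ 0 = 0 → γ₁ T = 0 → deriv γ₁ 0 = 0 → deriv γ₁ T = 0 →
      γ₂ 0 = 0 → γ₂ T = 0 → deriv γ₂ 0 = 0 → deriv γ₂ T = 0 →
      γ₃ 0 = 0 → γ₃ T = 0 → deriv γ₃ 0 = 0 → deriv γ₃ T = 0 →
      ∫ t in (0:ℝ)..T, (m * iteratedDeriv 2 x t * iteratedDeriv 2 γ₁ t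
          + m * iteratedDeriv 2 y t * iteratedDeriv 2 γ₂ t
          + J * iteratedDeriv 2 θ t * iteratedDeriv 2 γ₃ t
          + σ * (m * deriv x t * deriv γ₁ t + m * deriv y t * deriv γ₂ t
            + J * deriv θ t * deriv γ₃ t)
          - τ * (x t * γ₁ t + y t * γ₂ t) / (x t ^ 2 + y t ^ 2 - r ^ 2) ^ 2
          + η t * (Real.sin (θ t) * iteratedDeriv 2 x t - Real.cos (θ t) * iteratedDeriv 2 y t)
          + lam t * (Real.cos (θ t) * γ₃ t * iteratedDeriv 2 x t
              + Real.sin (θ t) * iteratedDeriv 2 γ₁ t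
              + Real.sin (θ t) * γ₃ t * iteratedDeriv 2 y t
              - Real.cos (θ t) * iteratedDeriv 2 γ₂ t)) = 0 := by
    intro γ₁ γ₂ γ₃ η h1 h2 h3 h4 a1 a2 a3 a4 b1 b2 b3 b4 c1 c2 c3 c4
    have H := hcrit γ₁ γ₂ γ₃ η h1 h2 h3 h4 a1 a2 a3 a4 b1 b2 b3 b4 c1 c2 c3 c4
    simp only [D1 x γ₁ hx h1, D1 y γ₂ hy h2, D1 θ γ₃ hθ h3, D2 x γ₁ hx h1, D2 y γ₂ hy h2,
      D2 θ γ₃ hθ h3] at H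
    have gc : ∀ g : ℝ → ℝ, ContDiff ℝ (⊤ : ℕ∞) g → ∀ k : ℕ, Continuous (iteratedDeriv k g) :=
      fun g hg k => hg.continuous_iteratedDeriv k (by exact_mod_cast le_top)
    have gc1 : ∀ g : ℝ → ℝ, ContDiff ℝ (⊤ : ℕ∞) g → Continuous (deriv g) :=
      fun g hg => by simpa using gc g hg 1
    refine Eq.trans (Eq.symm ?_) H
    exact (aux_fv m J T σ τ r hT x (deriv x) (iteratedDeriv 2 x) y (deriv y) (iteratedDeriv 2 y)
      θ (deriv θ) (iteratedDeriv 2 θ) lam γ₁ (deriv γ₁) (iteratedDeriv 2 γ₁)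
      γ₂ (deriv γ₂) (iteratedDeriv 2 γ₂) γ₃ (deriv γ₃) (iteratedDeriv 2 γ₃) η
      hx.continuous (by simpa using hxc 1 (by norm_num)) (hxc 2 (by norm_num))
      hy.continuous (by simpa using hyc 1 (by norm_num)) (hyc 2 (by norm_num))
      hθ.continuous (by simpa using hθc 1 (by norm_num)) (hθc 2 (by norm_num)) hlam.continuous
      h1.continuous (gc1 _ h1) (gc _ h1 2) h2.continuous (gc1 _ h2) (gc _ h2 2)
      h3.continuous (gc1 _ h3) (gc _ h3 2) h4.continuous hobs).deriv
  have z0 : ContDiff ℝ (⊤ : ℕ∞) (fun _ : ℝ => (0:ℝ)) := contDiff_const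
  have zd : ∀ t, deriv (fun _ : ℝ => (0:ℝ)) t = 0 := fun t => by simp
  have zd2 : ∀ t, iteratedDeriv 2 (fun _ : ℝ => (0:ℝ)) t = 0 := fun t => by
    simp
  have hDne : ∀ t ∈ Set.Icc (0:ℝ) T, x t ^ 2 + y t ^ 2 - r ^ 2 ≠ 0 := fun t ht =>
    (sub_pos.2 (hobs t ht)).ne'
  have cx := hx.continuous
  have cy := hy.continuous
  have cθ := hθ.continuous
  have cl := hlam.continuous
  have cx2 := hxc 2 (by norm_num)
  have cy2 := hyc 2 (by norm_num)
  have cθ2 := hθc 2 (by norm_num)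
  have cx4 := hxc 4 (by norm_num)
  have cy4 := hyc 4 (by norm_num)
  have cθ4 := hθc 4 (by norm_num)
  have cl2 := hlc 2 (by norm_num)
  have cθ1 : Continuous (deriv θ) := by simpa using hθc 1 (by norm_num)
  have cl1 : Continuous (deriv lam) := by simpa using hlc 1 (by norm_num)
  have dx1 : ∀ t, HasDerivAt (deriv x) (iteratedDeriv 2 x t) t := fun t => by
    simpa using hxd 1 (by norm_num) t
  have dy1 : ∀ t, HasDerivAt (deriv y) (iteratedDeriv 2 y t) t := fun t => by
    simpa using hyd 1 (by norm_num) t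
  have dθ0 : ∀ t, HasDerivAt θ (deriv θ t) t := fun t => by
    simpa using hθd 0 (by norm_num) t
  have dθ1 : ∀ t, HasDerivAt (deriv θ) (iteratedDeriv 2 θ t) t := fun t => by
    simpa using hθd 1 (by norm_num) t
  have dl0 : ∀ t, HasDerivAt lam (deriv lam t) t := fun t => by
    simpa using hld 0 (by norm_num) t
  have dl1 : ∀ t, HasDerivAt (deriv lam) (iteratedDeriv 2 lam t) t := fun t => by
    simpa using hld 1 (by norm_num) t
  have E0 := aux_EL hT (fun _ => 0) (fun _ => 0) (fun _ => 0) (fun _ => 0) (fun _ => 0)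
    (fun t => Real.sin (θ t) * iteratedDeriv 2 x t - Real.cos (θ t) * iteratedDeriv 2 y t)
    (fun t => hasDerivAt_const _ _) (fun t => hasDerivAt_const _ _) continuous_const
    (fun t => hasDerivAt_const _ _) continuous_const
    (Continuous.continuousOn (by fun_prop)) (by
      intro γ hγ g0 gT g0' gT'
      have H := fv (fun _ => 0) (fun _ => 0) (fun _ => 0) γ z0 z0 z0 hγ rfl rfl (zd _) (zd _)
        rfl rfl (zd _) (zd _) rfl rfl (zd _) (zd _)
      refine Eq.trans ?_ H
      congr 1; ext t
      simp only [zd, zd2]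
      ring)
  have E1 := aux_EL hT
    (fun t => m * iteratedDeriv 2 x t + lam t * Real.sin (θ t))
    (fun t => m * iteratedDeriv 3 x t + (deriv lam t * Real.sin (θ t)
      + lam t * (Real.cos (θ t) * deriv θ t)))
    (fun t => m * iteratedDeriv 4 x t + ((iteratedDeriv 2 lam t * Real.sin (θ t)
      + deriv lam t * (Real.cos (θ t) * deriv θ t)) + (deriv lam t * (Real.cos (θ t) * deriv θ t)
      + lam t * (-Real.sin (θ t) * deriv θ t * deriv θ t + Real.cos (θ t) * iteratedDeriv 2 θ t))))
    (fun t => σ * m * deriv x t) (fun t => σ * m * iteratedDeriv 2 x t)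
    (fun t => - (τ * x t / (x t ^ 2 + y t ^ 2 - r ^ 2) ^ 2))
    (fun t => ((hxd 2 (by norm_num) t).const_mul m).add ((dl0 t).mul (dθ0 t).sin))
    (fun t => ((hxd 3 (by norm_num) t).const_mul m).add (((dl1 t).mul (dθ0 t).sin).add
      ((dl0 t).mul ((dθ0 t).cos.mul (dθ1 t))))) (by fun_prop)
    (fun t => (dx1 t).const_mul _) (by fun_prop)
    (ContinuousOn.neg (ContinuousOn.div (by fun_prop) (by fun_prop)
      fun t ht => pow_ne_zero 2 (hDne t ht))) (by
      intro γ hγ g0 gT g0' gT'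
      have H := fv γ (fun _ => 0) (fun _ => 0) (fun _ => 0) hγ z0 z0 z0 g0 gT g0' gT'
        rfl rfl (zd _) (zd _) rfl rfl (zd _) (zd _)
      refine Eq.trans ?_ H
      congr 1; ext t
      simp only [zd, zd2]
      ring)
  have E2 := aux_EL hT
    (fun t => m * iteratedDeriv 2 y t - lam t * Real.cos (θ t))
    (fun t => m * iteratedDeriv 3 y t - (deriv lam t * Real.cos (θ t)
      + lam t * (-Real.sin (θ t) * deriv θ t)))
    (fun t => m * iteratedDeriv 4 y t - ((iteratedDeriv 2 lam t * Real.cos (θ t)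
      + deriv lam t * (-Real.sin (θ t) * deriv θ t)) + (deriv lam t * (-Real.sin (θ t) * deriv θ t)
      + lam t * (-(Real.cos (θ t) * deriv θ t) * deriv θ t
        + -Real.sin (θ t) * iteratedDeriv 2 θ t))))
    (fun t => σ * m * deriv y t) (fun t => σ * m * iteratedDeriv 2 y t)
    (fun t => - (τ * y t / (x t ^ 2 + y t ^ 2 - r ^ 2) ^ 2))
    (fun t => ((hyd 2 (by norm_num) t).const_mul m).sub ((dl0 t).mul (dθ0 t).cos))
    (fun t => ((hyd 3 (by norm_num) t).const_mul m).sub (((dl1 t).mul (dθ0 t).cos).add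
      ((dl0 t).mul ((dθ0 t).sin.neg.mul (dθ1 t))))) (by fun_prop)
    (fun t => (dy1 t).const_mul _) (by fun_prop)
    (ContinuousOn.neg (ContinuousOn.div (by fun_prop) (by fun_prop)
      fun t ht => pow_ne_zero 2 (hDne t ht))) (by
      intro γ hγ g0 gT g0' gT'
      have H := fv (fun _ => 0) γ (fun _ => 0) (fun _ => 0) z0 hγ z0 z0
        rfl rfl (zd _) (zd _) g0 gT g0' gT' rfl rfl (zd _) (zd _)
      refine Eq.trans ?_ H
      congr 1; ext t
      simp only [zd, zd2]
      ring)
  have E3 := aux_EL hT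
    (fun t => J * iteratedDeriv 2 θ t)
    (fun t => J * iteratedDeriv 3 θ t)
    (fun t => J * iteratedDeriv 4 θ t)
    (fun t => σ * J * deriv θ t) (fun t => σ * J * iteratedDeriv 2 θ t)
    (fun t => lam t * (Real.cos (θ t) * iteratedDeriv 2 x t + Real.sin (θ t) * iteratedDeriv 2 y t))
    (fun t => (hθd 2 (by norm_num) t).const_mul J)
    (fun t => (hθd 3 (by norm_num) t).const_mul J) (by fun_prop)
    (fun t => (dθ1 t).const_mul _) (by fun_prop)
    (Continuous.continuousOn (by fun_prop)) (by
      intro γ hγ g0 gT g0' gT'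
      have H := fv (fun _ => 0) (fun _ => 0) γ (fun _ => 0) z0 z0 hγ z0
        rfl rfl (zd _) (zd _) rfl rfl (zd _) (zd _) g0 gT g0' gT'
      refine Eq.trans ?_ H
      congr 1; ext t
      simp only [zd, zd2]
      ring)
  intro t ht
  have hne := hDne t ht
  refine ⟨?_, ?_, ?_, ?_⟩
  · have := E0 t ht
    simpa using this
  · have := E1 t ht
    refine (mul_eq_zero.1 (Eq.trans ?_ this)).resolve_left hm.ne'
    field_simp
    ring
  · have := E2 t ht
    refine (mul_eq_zero.1 (Eq.trans ?_ this)).resolve_left hm.ne'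
    field_simp
    ring
  · have := E3 t ht
    refine (mul_eq_zero.1 (Eq.trans ?_ this)).resolve_left hJ.ne'
    field_simp
end
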